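/- arXiv:2412.16929 — 6 statements merged into one kernel-verified Lean document; each statement's English description precedes it below -/
import Mathlib

section
/- Let K be a commutative ℚ-algebra, R = K[x_1, x_2, …] the polynomial ring in countably many variables, λ ∈ K, and r a positive integer. Define K-linear operators α_n (n ∈ ℤ) on R by: α_0 = λ·id; for 1 ≤ n ≤ r, α_n = multiplication by −x_n and α_{−n} = n·(∂/∂x_n); for n > r, α_n = n·(∂/∂x_n) and α_{−n} = multiplication by x_n. Then for all m, n ∈ ℤ one has α_n ∘ α_m − α_m ∘ α_n = n·δ_{n+m,0}·id_R; that is, these operators define a representation of the Heisenberg algebra on R (the irregular Fock representation of degree r). -/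
/-!
STATEMENT 0: The irregular Fock representation of degree `r` of the Heisenberg
algebra on the polynomial ring `K[x_1, x_2, …]`.  We realize the polynomial
ring in countably many variables as `MvPolynomial ℕ K`, where the variable
`x_n` (for `n ≥ 1`) is `MvPolynomial.X (n - 1)`.
-/

open MvPolynomial

/-- The operators `α_n` of the degree-`r` irregular Fock representation:
`α_0 = λ·id`; for `1 ≤ n ≤ r`, `α_n` is multiplication by `−x_n` and
`α_{−n} = n·∂/∂x_n`; for `n > r`, `α_n = n·∂/∂x_n` and `α_{−n}` is
multiplication by `x_n`. -/
noncomputable def heisenbergIrregular (K : Type*) [CommRing K] [Algebra ℚ K]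
    (lam : K) (r : ℕ) (n : ℤ) : Module.End K (MvPolynomial ℕ K) :=
  if n = 0 then lam • (1 : Module.End K (MvPolynomial ℕ K))
  else if 0 < n then
    (if n ≤ (r : ℤ) then
      -(LinearMap.mulLeft K (X (n.toNat - 1) : MvPolynomial ℕ K))
    else
      (n : K) • ((pderiv (n.toNat - 1) :
        Derivation K (MvPolynomial ℕ K) (MvPolynomial ℕ K)).toLinearMap))
  else
    (if -n ≤ (r : ℤ) then
      ((-n : ℤ) : K) • ((pderiv ((-n).toNat - 1) :
        Derivation K (MvPolynomial ℕ K) (MvPolynomial ℕ K)).toLinearMap)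
    else
      LinearMap.mulLeft K (X ((-n).toNat - 1) : MvPolynomial ℕ K))

theorem hI_comm_pd (K : Type*) [CommRing K] (i j : ℕ) (p : MvPolynomial ℕ K) :
    pderiv i (pderiv j p) = pderiv j (pderiv i p) := by
  have h : ⁅(pderiv i : Derivation K (MvPolynomial ℕ K) (MvPolynomial ℕ K)), (pderiv j : Derivation K (MvPolynomial ℕ K) (MvPolynomial ℕ K))⁆ = 0 := by
    apply MvPolynomial.derivation_ext
    intro k
    simp [Derivation.commutator_apply, pderiv_X, Pi.single_apply, apply_ite]
  have h2 := congrArg (fun D : Derivation K (MvPolynomial ℕ K) (MvPolynomial ℕ K) => D p) h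
  simpa [Derivation.commutator_apply, sub_eq_zero] using h2

theorem hI_pd_X (K : Type*) [CommRing K] (i j : ℕ) (p : MvPolynomial ℕ K) :
    pderiv i (X j * p) = X j * pderiv i p + (if i = j then p else 0) := by
  rw [Derivation.leibniz, pderiv_X, Pi.single_apply]
  by_cases h : i = j
  · subst h; simp
  · simp [h, Ne.symm h]

/-- The operators `α_n` satisfy the Heisenberg relations
`[α_n, α_m] = n δ_{n+m,0} · id`, i.e. they define a representation of the
Heisenberg algebra on `K[x_1, x_2, …]` (the irregular Fock representation of
degree `r`). -/
theorem heisenbergIrregular_commutator (K : Type*) [CommRing K] [Algebra ℚ K]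
    (lam : K) (r : ℕ) (hr : 0 < r) (n m : ℤ) :
    heisenbergIrregular K lam r n * heisenbergIrregular K lam r m
      - heisenbergIrregular K lam r m * heisenbergIrregular K lam r n
      = if n + m = 0 then (n : K) • (1 : Module.End K (MvPolynomial ℕ K))
        else 0 := by
  apply LinearMap.ext
  intro p
  have hm : n + m = 0 → (m : K) = -(n : K) := by
    intro h
    rw [show m = -n by omega, Int.cast_neg]
  unfold heisenbergIrregular
  split_ifs <;> first
    | (exfalso; omega)
    | (simp only [LinearMap.sub_apply, Module.End.mul_apply, LinearMap.smul_apply,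
        LinearMap.neg_apply, LinearMap.mulLeft_apply, Derivation.coeFn_coe, map_smul, map_neg,
        Module.End.one_apply, LinearMap.zero_apply, hI_pd_X, Derivation.map_smul,
        Derivation.map_neg, mul_neg, mul_smul_comm]
       try rw [hI_comm_pd K (_ - 1) (m.toNat - 1)]
       try rw [hI_comm_pd K (_ - 1) ((-m).toNat - 1)]
       try rw [if_pos (by omega)]
       try rw [if_neg (by omega)]
       try subst_vars
       try simp only [MvPolynomial.smul_eq_C_mul, Int.cast_neg, Int.cast_zero, map_neg, map_zero,
         neg_neg]
       try rw [hm (by assumption), map_neg]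
       ring)
end

section
/- Let K be a commutative ℚ-algebra with elements λ, θ, and define K-linear operators on the polynomial ring K[x_1, x_2]: L_0 = x_1·∂_1 + 2x_2·∂_2 + λ(θ−λ)·id, L_1 = multiplication by −2(λ−θ)x_1 minus x_2·∂_1, L_2 = multiplication by −x_1² − (2λ−3θ)x_2, L_3 = multiplication by −2x_1x_2, L_4 = multiplication by −x_2². Then these operators satisfy: [L_0, L_n] = n·L_n for n = 1, 2, 3, 4; [L_2, L_1] = L_3; [L_1, L_3] = −2·L_4; and [L_1, L_4] = [L_2, L_3] = [L_2, L_4] = [L_3, L_4] = 0. In particular the relation [L_2, L_1] = L_3 claimed for the degree-2 Gaiotto–Teschner irregular state holds. -/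
/-!
STATEMENT 2: The operators defining the degree-2 Gaiotto–Teschner irregular
Virasoro state, acting on the polynomial ring `K[x_1, x_2]` (realized as
`MvPolynomial (Fin 2) K`, with `x_1 = X 0`, `x_2 = X 1`):
`L_0 = x_1·∂_1 + 2x_2·∂_2 + λ(θ−λ)·id`,
`L_1 = mult. by −2(λ−θ)x_1 − x_2·∂_1`,
`L_2 = mult. by −x_1² − (2λ−3θ)x_2`,
`L_3 = mult. by −2x_1x_2`, `L_4 = mult. by −x_2²`.
They satisfy `[L_0, L_n] = n·L_n` for `n = 1,2,3,4`, `[L_2, L_1] = L_3`,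
`[L_1, L_3] = −2·L_4`, and `[L_1,L_4] = [L_2,L_3] = [L_2,L_4] = [L_3,L_4] = 0`.
-/

open MvPolynomial

noncomputable def GT2L0 (K : Type*) [CommRing K] [Algebra ℚ K] (lam θ : K) :
    Module.End K (MvPolynomial (Fin 2) K) :=
  (LinearMap.mulLeft K (X 0 : MvPolynomial (Fin 2) K)) ∘ₗ
      ((pderiv 0 : Derivation K (MvPolynomial (Fin 2) K)
        (MvPolynomial (Fin 2) K)).toLinearMap)
    + (LinearMap.mulLeft K (C 2 * X 1 : MvPolynomial (Fin 2) K)) ∘ₗ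
      ((pderiv 1 : Derivation K (MvPolynomial (Fin 2) K)
        (MvPolynomial (Fin 2) K)).toLinearMap)
    + (lam * (θ - lam)) • (1 : Module.End K (MvPolynomial (Fin 2) K))

noncomputable def GT2L1 (K : Type*) [CommRing K] [Algebra ℚ K] (lam θ : K) :
    Module.End K (MvPolynomial (Fin 2) K) :=
  LinearMap.mulLeft K (C (-2 * (lam - θ)) * X 0 : MvPolynomial (Fin 2) K)
    - (LinearMap.mulLeft K (X 1 : MvPolynomial (Fin 2) K)) ∘ₗ
      ((pderiv 0 : Derivation K (MvPolynomial (Fin 2) K)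
        (MvPolynomial (Fin 2) K)).toLinearMap)

noncomputable def GT2L2 (K : Type*) [CommRing K] [Algebra ℚ K] (lam θ : K) :
    Module.End K (MvPolynomial (Fin 2) K) :=
  LinearMap.mulLeft K
    (-(X 0 ^ 2) - C (2 * lam - 3 * θ) * X 1 : MvPolynomial (Fin 2) K)

noncomputable def GT2L3 (K : Type*) [CommRing K] [Algebra ℚ K] :
    Module.End K (MvPolynomial (Fin 2) K) :=
  LinearMap.mulLeft K (C (-2) * (X 0 * X 1) : MvPolynomial (Fin 2) K)

noncomputable def GT2L4 (K : Type*) [CommRing K] [Algebra ℚ K] :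
    Module.End K (MvPolynomial (Fin 2) K) :=
  LinearMap.mulLeft K (-(X 1 ^ 2) : MvPolynomial (Fin 2) K)

theorem GT2_pderiv_comm (K : Type*) [CommRing K] (p : MvPolynomial (Fin 2) K) :
    pderiv (R := K) 1 (pderiv (R := K) 0 p) = pderiv (R := K) 0 (pderiv (R := K) 1 p) := by
  have h : ⁅(pderiv 1 : Derivation K (MvPolynomial (Fin 2) K) (MvPolynomial (Fin 2) K)),
      (pderiv 0 : Derivation K (MvPolynomial (Fin 2) K) (MvPolynomial (Fin 2) K))⁆ = 0 := by
    apply MvPolynomial.derivation_ext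
    intro i
    fin_cases i <;> simp [Derivation.commutator_apply, pderiv_X]
  have h2 := congrArg (fun D => D p) h
  simp only [Derivation.commutator_apply, Derivation.zero_apply] at h2
  exact sub_eq_zero.mp h2

/-- The commutation relations of the degree-2 Gaiotto–Teschner irregular
operators; in particular `[L_2, L_1] = L_3`. -/
theorem gaiottoTeschner_degree_two_relations (K : Type*) [CommRing K]
    [Algebra ℚ K] (lam θ : K) :
    (GT2L0 K lam θ * GT2L1 K lam θ - GT2L1 K lam θ * GT2L0 K lam θ
        = GT2L1 K lam θ)
    ∧ (GT2L0 K lam θ * GT2L2 K lam θ - GT2L2 K lam θ * GT2L0 K lam θ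
        = 2 • GT2L2 K lam θ)
    ∧ (GT2L0 K lam θ * GT2L3 K - GT2L3 K * GT2L0 K lam θ = 3 • GT2L3 K)
    ∧ (GT2L0 K lam θ * GT2L4 K - GT2L4 K * GT2L0 K lam θ = 4 • GT2L4 K)
    ∧ (GT2L2 K lam θ * GT2L1 K lam θ - GT2L1 K lam θ * GT2L2 K lam θ
        = GT2L3 K)
    ∧ (GT2L1 K lam θ * GT2L3 K - GT2L3 K * GT2L1 K lam θ = -(2 • GT2L4 K))
    ∧ (GT2L1 K lam θ * GT2L4 K - GT2L4 K * GT2L1 K lam θ = 0)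
    ∧ (GT2L2 K lam θ * GT2L3 K - GT2L3 K * GT2L2 K lam θ = 0)
    ∧ (GT2L2 K lam θ * GT2L4 K - GT2L4 K * GT2L2 K lam θ = 0)
    ∧ (GT2L3 K * GT2L4 K - GT2L4 K * GT2L3 K = 0) := by
  have h01 : pderiv 0 (X 1 : MvPolynomial (Fin 2) K) = 0 := pderiv_X_of_ne (by decide)
  have h10 : pderiv 1 (X 0 : MvPolynomial (Fin 2) K) = 0 := pderiv_X_of_ne (by decide)
  have h2 : (C 2 : MvPolynomial (Fin 2) K) = 2 := map_ofNat C 2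
  have h3 : (C 3 : MvPolynomial (Fin 2) K) = 3 := map_ofNat C 3
  have d2 : ∀ i, pderiv i (2 : MvPolynomial (Fin 2) K) = 0 := fun i => by rw [← h2, pderiv_C]
  have d3 : ∀ i, pderiv i (3 : MvPolynomial (Fin 2) K) = 0 := fun i => by rw [← h3, pderiv_C]
  refine ⟨?_, ?_, ?_, ?_, ?_, ?_, ?_, ?_, ?_, ?_⟩ <;>
  · refine LinearMap.ext fun p => ?_
    simp only [GT2L0, GT2L1, GT2L2, GT2L3, GT2L4, LinearMap.sub_apply, LinearMap.add_apply,
      LinearMap.neg_apply, LinearMap.zero_apply, LinearMap.smul_apply, Module.End.mul_apply,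
      Module.End.one_apply, LinearMap.comp_apply, LinearMap.mulLeft_apply,
      Derivation.coeFn_coe, Derivation.leibniz, Derivation.leibniz_pow, map_add, map_sub, map_neg,
      map_mul, smul_eq_C_mul, smul_eq_mul, pderiv_C, d2, d3, pderiv_X_self, h01, h10, h2, h3,
      GT2_pderiv_comm]
    try simp only [nsmul_eq_mul]
    try push_cast
    try ring
end

section
/- Assume the sl(2)-family setup. Then for pairwise distinct indices a, b, c one has the infinitesimal braid relation [Ω_{ab}, Ω_{ac} + Ω_{bc}] = 0, and for pairwise distinct indices a, b, c, d one has [Ω_{ab}, Ω_{cd}] = 0. -/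
/-!
The sl(2)-family setup: `K` a field of characteristic zero, `V` a `K`-vector
space, and for each `i : Fin N` endomorphisms `H i`, `X i`, `Y i` of `V` such
that operators belonging to different indices commute, and for each `i` the
sl(2) relations `[H_i,X_i] = 2X_i`, `[H_i,Y_i] = −2Y_i`, `[X_i,Y_i] = H_i`
hold.  For `a ≠ b`, `Ω_{ab} = (1/2)H_aH_b + X_aY_b + Y_aX_b`.
-/

/-- `Ω_{ab} = (1/2)·H_a H_b + X_a Y_b + Y_a X_b`. -/
noncomputable def Omega {K : Type*} [Field K] [CharZero K] {V : Type*}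
    [AddCommGroup V] [Module K V] {N : ℕ}
    (H X Y : Fin N → Module.End K V) (a b : Fin N) : Module.End K V :=
  ((2 : K)⁻¹) • (H a * H b) + X a * Y b + Y a * X b

theorem aux_comm {K R : Type*} [Field K] [CharZero K] [Ring R] [Algebra K R]
    (h x y h' x' y' : R)
    (hx : h * x - x * h = 2 • x) (hy : h * y - y * h = -(2 • y)) (xy : x * y - y * x = h)
    (hx' : h' * x' - x' * h' = 2 • x') (hy' : h' * y' - y' * h' = -(2 • y'))
    (xy' : x' * y' - y' * x' = h')
    (c1 : h' * h = h * h') (c2 : h' * x = x * h') (c3 : h' * y = y * h')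
    (c4 : x' * h = h * x') (c5 : x' * x = x * x') (c6 : x' * y = y * x')
    (c7 : y' * h = h * y') (c8 : y' * x = x * y') (c9 : y' * y = y * y') :
    Commute (((2 : K)⁻¹) • (h * h') + x * y' + y * x') (h + h') ∧
    Commute (((2 : K)⁻¹) • (h * h') + x * y' + y * x') (x + x') ∧
    Commute (((2 : K)⁻¹) • (h * h') + x * y' + y * x') (y + y') := by
  have e1 : x * h = h * x - (2 : K) • x := by
    rw [show (2 : K) • x = 2 • x by module, ← hx]; abel
  have e2 : h * y = y * h - (2 : K) • y := by
    rw [show (2 : K) • y = -(-(2 • y)) by module, ← hy]; abel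
  have e3 : x * y = y * x + h := by rw [← xy]; abel
  have f1 : x' * h' = h' * x' - (2 : K) • x' := by
    rw [show (2 : K) • x' = 2 • x' by module, ← hx']; abel
  have f2 : h' * y' = y' * h' - (2 : K) • y' := by
    rw [show (2 : K) • y' = -(-(2 • y')) by module, ← hy']; abel
  have f3 : x' * y' = y' * x' + h' := by rw [← xy']; abel
  have L : ∀ {p q r : R}, p * q = r → ∀ z, p * (q * z) = r * z := by
    intro p q r e z; rw [← mul_assoc, e]
  refine ⟨?_, ?_, ?_⟩ <;>
  · unfold Commute SemiconjBy
    simp only [mul_add, add_mul, sub_mul, mul_sub, smul_mul_assoc, mul_smul_comm, mul_assoc,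
      e1, e2, e3, f1, f2, f3, c1, c2, c3, c4, c5, c6, c7, c8, c9,
      L e1, L e2, L e3, L f1, L f2, L f3, L c1, L c2, L c3, L c4, L c5, L c6, L c7, L c8, L c9]
    match_scalars <;> norm_num

/-- the infinitesimal braid relations:
`[Ω_{ab}, Ω_{ac} + Ω_{bc}] = 0` for pairwise distinct `a, b, c`, and
`[Ω_{ab}, Ω_{cd}] = 0` for pairwise distinct `a, b, c, d`. -/
theorem Omega_infinitesimal_braid_relations
    {K : Type*} [Field K] [CharZero K] {V : Type*} [AddCommGroup V]
    [Module K V] {N : ℕ} (H X Y : Fin N → Module.End K V)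
    (hcomm : ∀ i j, i ≠ j →
      ∀ A ∈ [H i, X i, Y i], ∀ B ∈ [H j, X j, Y j], Commute A B)
    (hHX : ∀ i, H i * X i - X i * H i = 2 • X i)
    (hHY : ∀ i, H i * Y i - Y i * H i = -(2 • Y i))
    (hXY : ∀ i, X i * Y i - Y i * X i = H i) :
    (∀ a b c : Fin N, a ≠ b → a ≠ c → b ≠ c →
      Omega H X Y a b * (Omega H X Y a c + Omega H X Y b c)
        - (Omega H X Y a c + Omega H X Y b c) * Omega H X Y a b = 0)
    ∧ (∀ a b c d : Fin N, a ≠ b → a ≠ c → a ≠ d → b ≠ c → b ≠ d → c ≠ d →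
      Omega H X Y a b * Omega H X Y c d
        - Omega H X Y c d * Omega H X Y a b = 0) := by
  have C : ∀ i j, i ≠ j →
      ((H i * H j = H j * H i ∧ H i * X j = X j * H i ∧ H i * Y j = Y j * H i) ∧
      (X i * H j = H j * X i ∧ X i * X j = X j * X i ∧ X i * Y j = Y j * X i) ∧
      (Y i * H j = H j * Y i ∧ Y i * X j = X j * Y i ∧ Y i * Y j = Y j * Y i)) := by
    intro i j hij
    refine ⟨⟨?_, ?_, ?_⟩, ⟨?_, ?_, ?_⟩, ⟨?_, ?_, ?_⟩⟩ <;>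
    exact hcomm i j hij _ (by simp) _ (by simp)
  have D : ∀ a b c, a ≠ c → b ≠ c → Commute (Omega H X Y a b) (H c) ∧
      Commute (Omega H X Y a b) (X c) ∧ Commute (Omega H X Y a b) (Y c) := by
    intro a b c hac hbc
    obtain ⟨⟨a1, a2, a3⟩, ⟨a4, a5, a6⟩, a7, a8, a9⟩ := C a c hac
    obtain ⟨⟨b1, b2, b3⟩, ⟨b4, b5, b6⟩, b7, b8, b9⟩ := C b c hbc
    unfold Omega
    refine ⟨?_, ?_, ?_⟩
    · exact (((Commute.mul_left a1 b1).smul_left _).add_left (Commute.mul_left a4 b7)).add_left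
        (Commute.mul_left a7 b4)
    · exact (((Commute.mul_left a2 b2).smul_left _).add_left (Commute.mul_left a5 b8)).add_left
        (Commute.mul_left a8 b5)
    · exact (((Commute.mul_left a3 b3).smul_left _).add_left (Commute.mul_left a6 b9)).add_left
        (Commute.mul_left a9 b6)
  constructor
  · intro a b c hab hac hbc
    obtain ⟨d1, d2, d3⟩ := D a b c hac hbc
    obtain ⟨⟨b1, b2, b3⟩, ⟨b4, b5, b6⟩, b7, b8, b9⟩ := C b a hab.symm
    obtain ⟨g1, g2, g3⟩ := aux_comm (K := K) (H a) (X a) (Y a) (H b) (X b) (Y b)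
      (hHX a) (hHY a) (hXY a) (hHX b) (hHY b) (hXY b) b1 b2 b3 b4 b5 b6 b7 b8 b9
    have e : Omega H X Y a c + Omega H X Y b c =
        ((2 : K)⁻¹) • ((H a + H b) * H c) + (X a + X b) * Y c + (Y a + Y b) * X c := by
      simp only [Omega, add_mul, smul_add]; abel
    rw [e, sub_eq_zero]
    exact (((Commute.mul_right g1 d1).smul_right _).add_right (Commute.mul_right g2 d3)).add_right
      (Commute.mul_right g3 d2)
  · intro a b c d hab hac had hbc hbd hcd
    obtain ⟨c1, c2, c3⟩ := D a b c hac hbc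
    obtain ⟨d1, d2, d3⟩ := D a b d had hbd
    rw [sub_eq_zero]
    exact (((Commute.mul_right c1 d1).smul_right _).add_right (Commute.mul_right c2 d3)).add_right
      (Commute.mul_right c3 d2)
end

section
/- Assume the sl(2)-family setup over K = ℂ (or any field of characteristic zero), let Λ ∈ K, and let z_1, …, z_N ∈ K be pairwise distinct. Define for each i the operator A_i = (Λ/2)·H_i + ∑_{j ≠ i} Ω_{ij}/(z_i − z_j). Then [A_i, A_j] = 0 for all i ≠ j. Consequently (since ∂A_j/∂z_i = Ω_{ij}/(z_j − z_i)² = ∂A_i/∂z_j), the degree-1 irregular KZ connection ∇_i = ∂/∂z_i − A_i on the trivial bundle over the configuration space of N distinct points is flat. -/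
set_option linter.unusedSimpArgs false
set_option linter.unusedSectionVars false
section helpers
variable {K : Type*} [Field K] [CharZero K] {R : Type*} [Ring R] [Algebra K R]

theorem sl2_cas (h x y h' x' y' : R)
    (hx : h * x = x * h + 2 • x) (hy : h * y = y * h - 2 • y) (xy : x * y = y * x + h)
    (hx' : h' * x' = x' * h' + 2 • x') (hy' : h' * y' = y' * h' - 2 • y')
    (xy' : x' * y' = y' * x' + h')
    (c1 : h' * h = h * h') (c2 : h' * x = x * h') (c3 : h' * y = y * h')
    (c4 : x' * h = h * x') (c5 : x' * x = x * x') (c6 : x' * y = y * x')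
    (c7 : y' * h = h * y') (c8 : y' * x = x * y') (c9 : y' * y = y * y') :
    Commute ((2 : K)⁻¹ • (h * h') + x * y' + y * x') (h + h') ∧
    Commute ((2 : K)⁻¹ • (h * h') + x * y' + y * x') (x + x') ∧
    Commute ((2 : K)⁻¹ • (h * h') + x * y' + y * x') (y + y') := by
  have as : ∀ {a b c : R}, a * b = c → ∀ d, a * (b * d) = c * d := by
    intro a b c e d; rw [← mul_assoc, e]
  have e1 := as hx
  have e2 := as hy
  have e3 := as xy
  have e4 := as hx'
  have e5 := as hy'
  have e6 := as xy'
  have d1 := as c1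
  have d2 := as c2
  have d3 := as c3
  have d4 := as c4
  have d5 := as c5
  have d6 := as c6
  have d7 := as c7
  have d8 := as c8
  have d9 := as c9
  refine ⟨?_, ?_, ?_⟩ <;> unfold Commute SemiconjBy <;>
  simp only [mul_add, add_mul, sub_mul, mul_sub, smul_mul_assoc, mul_smul_comm, mul_assoc, hx, hy, xy, hx', hy', xy',
    c1, c2, c3, c4, c5, c6, c7, c8, c9, e1, e2, e3, e4, e5, e6, d1, d2, d3, d4, d5, d6, d7, d8, d9] <;>
  module

def br (a b : R) : R := a * b - b * a
theorem br_def (a b : R) : br a b = a * b - b * a := rfl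
theorem br_lie_add (a b c : R) : br a (b + c) = br a b + br a c := by
  unfold br; noncomm_ring
theorem br_add_lie (a b c : R) : br (a + b) c = br a c + br b c := by
  unfold br; noncomm_ring
theorem br_lie_smul (t : K) (a b : R) : br a (t • b) = t • br a b := by
  unfold br; rw [mul_smul_comm, smul_mul_assoc, smul_sub]
theorem br_smul_lie (t : K) (a b : R) : br (t • a) b = t • br a b := by
  unfold br; rw [mul_smul_comm, smul_mul_assoc, smul_sub]
theorem br_lie_sum {ι : Type*} (s : Finset ι) (a : R) (f : ι → R) :
    br a (∑ k ∈ s, f k) = ∑ k ∈ s, br a (f k) := by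
  unfold br; rw [Finset.mul_sum, Finset.sum_mul, Finset.sum_sub_distrib]
theorem br_sum_lie {ι : Type*} (s : Finset ι) (a : R) (f : ι → R) :
    br (∑ k ∈ s, f k) a = ∑ k ∈ s, br (f k) a := by
  unfold br; rw [Finset.mul_sum, Finset.sum_mul, Finset.sum_sub_distrib]
theorem br_lie_skew (a b : R) : -br b a = br a b := by
  unfold br; abel
theorem br_lie_self (a : R) : br a a = 0 := sub_self _
theorem _root_.Commute.br_eq {a b : R} (h : Commute a b) : br a b = 0 := sub_eq_zero.mpr h.eq
end helpers

section fam
variable {K : Type*} [Field K] [CharZero K] {V : Type*} [AddCommGroup V]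
    [Module K V] {N : ℕ} (H X Y : Fin N → Module.End K V)
    (hcomm : ∀ i j, i ≠ j →
      ∀ A ∈ [H i, X i, Y i], ∀ B ∈ [H j, X j, Y j], Commute A B)

theorem fam_cas (hcomm : ∀ i j, i ≠ j →
      ∀ A ∈ [H i, X i, Y i], ∀ B ∈ [H j, X j, Y j], Commute A B)
    (hHX : ∀ i, H i * X i - X i * H i = 2 • X i)
    (hHY : ∀ i, H i * Y i - Y i * H i = -(2 • Y i))
    (hXY : ∀ i, X i * Y i - Y i * X i = H i) (i j : Fin N) (hij : i ≠ j) :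
    Commute (Omega H X Y i j) (H i + H j) ∧ Commute (Omega H X Y i j) (X i + X j) ∧
    Commute (Omega H X Y i j) (Y i + Y j) := by
  have h1 : ∀ i, H i * X i = X i * H i + 2 • X i := fun i => by rw [← hHX]; abel
  have h2 : ∀ i, H i * Y i = Y i * H i - 2 • Y i := fun i => by
    rw [sub_eq_add_neg, ← hHY]; abel
  have h3 : ∀ i, X i * Y i = Y i * X i + H i := fun i => by
    conv_rhs => rw [← hXY]
    abel
  have hc := hcomm j i hij.symm
  unfold Omega
  apply sl2_cas (K := K) _ _ _ _ _ _ (h1 i) (h2 i) (h3 i) (h1 j) (h2 j) (h3 j)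
  all_goals exact hc _ (by simp) _ (by simp)

theorem omega_symm (hcomm : ∀ i j, i ≠ j →
      ∀ A ∈ [H i, X i, Y i], ∀ B ∈ [H j, X j, Y j], Commute A B)
    (i j : Fin N) (hij : i ≠ j) : Omega H X Y i j = Omega H X Y j i := by
  have hc := hcomm j i hij.symm
  unfold Omega
  rw [(hc (H j) (by simp) (H i) (by simp)).eq, (hc (X j) (by simp) (Y i) (by simp)).eq,
    (hc (Y j) (by simp) (X i) (by simp)).eq]
  abel

theorem omega_comm (hcomm : ∀ i j, i ≠ j →
      ∀ A ∈ [H i, X i, Y i], ∀ B ∈ [H j, X j, Y j], Commute A B)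
    (i j k : Fin N) (hi : i ≠ k) (hj : j ≠ k) :
    Commute (Omega H X Y i j) (H k) ∧ Commute (Omega H X Y i j) (X k) ∧
    Commute (Omega H X Y i j) (Y k) := by
  have hi := hcomm i k hi
  have hj := hcomm j k hj
  have key : ∀ B ∈ [H k, X k, Y k], Commute (Omega H X Y i j) B := by
    intro B hB
    unfold Omega
    exact (((((hi _ (by simp) B hB).mul_left (hj _ (by simp) B hB)).smul_left _).add_left
      ((hi _ (by simp) B hB).mul_left (hj _ (by simp) B hB))).add_left
      ((hi _ (by simp) B hB).mul_left (hj _ (by simp) B hB)))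
  exact ⟨key _ (by simp), key _ (by simp), key _ (by simp)⟩

theorem omega_three (hcomm : ∀ i j, i ≠ j →
      ∀ A ∈ [H i, X i, Y i], ∀ B ∈ [H j, X j, Y j], Commute A B)
    (hHX : ∀ i, H i * X i - X i * H i = 2 • X i)
    (hHY : ∀ i, H i * Y i - Y i * H i = -(2 • Y i))
    (hXY : ∀ i, X i * Y i - Y i * X i = H i) (i j k : Fin N)
    (hij : i ≠ j) (hi : i ≠ k) (hj : j ≠ k) :
    Commute (Omega H X Y i j) (Omega H X Y i k + Omega H X Y j k) := by
  obtain ⟨a, b, c⟩ := fam_cas H X Y hcomm hHX hHY hXY i j hij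
  obtain ⟨a', b', c'⟩ := omega_comm H X Y hcomm i j k hi hj
  have : Omega H X Y i k + Omega H X Y j k =
      (2 : K)⁻¹ • ((H i + H j) * H k) + (X i + X j) * Y k + (Y i + Y j) * X k := by
    unfold Omega
    simp only [add_mul, smul_add]
    abel
  rw [this]
  exact (((a.mul_right a').smul_right _).add_right (b.mul_right c')).add_right (c.mul_right b')

end fam

open Finset in
/-- the operators `A_i = (Λ/2)·H_i + ∑_{j ≠ i} Ω_{ij}/(z_i − z_j)`
pairwise commute, i.e. the degree-1 irregular KZ connection
`∇_i = ∂/∂z_i − A_i` is flat. -/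
theorem irregular_KZ_flatness
    {K : Type*} [Field K] [CharZero K] {V : Type*} [AddCommGroup V]
    [Module K V] {N : ℕ} (H X Y : Fin N → Module.End K V)
    (hcomm : ∀ i j, i ≠ j →
      ∀ A ∈ [H i, X i, Y i], ∀ B ∈ [H j, X j, Y j], Commute A B)
    (hHX : ∀ i, H i * X i - X i * H i = 2 • X i)
    (hHY : ∀ i, H i * Y i - Y i * H i = -(2 • Y i))
    (hXY : ∀ i, X i * Y i - Y i * X i = H i)
    (Λ : K) (z : Fin N → K) (hz : ∀ i j, i ≠ j → z i ≠ z j)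
    (A : Fin N → Module.End K V)
    (hA : ∀ i, A i = (Λ / 2) • H i
      + ∑ j ∈ Finset.univ.erase i, (z i - z j)⁻¹ • Omega H X Y i j) :
    ∀ i j, i ≠ j → A i * A j = A j * A i := by
  intro i j hij
  have hji := hij.symm
  set O := Omega H X Y with hO
  have h3 := omega_three H X Y hcomm hHX hHY hXY
  have hs := omega_symm H X Y hcomm
  have hc := omega_comm H X Y hcomm
  set S := (Finset.univ.erase i).erase j with hS
  have hS' : S = (Finset.univ.erase j).erase i := Finset.erase_right_comm
  have hmem : ∀ k ∈ S, i ≠ k ∧ j ≠ k := by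
    intro k hk
    simp [hS] at hk
    exact ⟨Ne.symm hk.2, Ne.symm hk.1⟩
  have hAi : A i = (Λ / 2) • H i + ((z i - z j)⁻¹ • O i j + ∑ k ∈ S, (z i - z k)⁻¹ • O i k) := by
    rw [hA, hS, Finset.add_sum_erase _ (fun k => (z i - z k)⁻¹ • O i k) (by simp [hji])]
  have hAj : A j = (Λ / 2) • H j + (-(z i - z j)⁻¹ • O i j + ∑ k ∈ S, (z j - z k)⁻¹ • O j k) := by
    rw [hA, hS', hO, hs i j hij, ← hO, ← inv_neg, neg_sub,
      Finset.add_sum_erase _ (fun k => (z j - z k)⁻¹ • O j k) (by simp [hij])]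
  have b1 : (br (H i) (H j)) = 0 := (hcomm i j hij _ (by simp) _ (by simp)).br_eq
  have b2 : (br (O i j) (H j)) = -(br (O i j) (H i)) := by
    have := (fam_cas H X Y hcomm hHX hHY hXY i j hij).1.br_eq
    rw [br_lie_add] at this
    exact eq_neg_of_add_eq_zero_right this
  have b3 : (br (H i) (∑ k ∈ S, (z j - z k)⁻¹ • O j k)) = 0 := by
    rw [br_lie_sum]
    refine Finset.sum_eq_zero fun k hk => ?_
    obtain ⟨p, q⟩ := hmem k hk
    rw [br_lie_smul, ((hc j k i hji p.symm).1.symm).br_eq, smul_zero]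
  have b4 : (br (∑ k ∈ S, (z i - z k)⁻¹ • O i k) (H j)) = 0 := by
    rw [br_sum_lie]
    refine Finset.sum_eq_zero fun k hk => ?_
    obtain ⟨p, q⟩ := hmem k hk
    rw [br_smul_lie, ((hc i k j hij q.symm).1).br_eq, smul_zero]
  have b5 : (br (∑ k ∈ S, (z i - z k)⁻¹ • O i k) (∑ k ∈ S, (z j - z k)⁻¹ • O j k)) =
      ∑ k ∈ S, ((z i - z k)⁻¹ * (z j - z k)⁻¹) • (br (O i k) (O j k)) := by
    rw [br_sum_lie]
    refine Finset.sum_congr rfl fun k hk => ?_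
    obtain ⟨p, q⟩ := hmem k hk
    rw [br_lie_sum, Finset.sum_eq_single_of_mem k hk, br_smul_lie, br_lie_smul, smul_smul]
    intro l hl hlk
    obtain ⟨p', q'⟩ := hmem l hl
    obtain ⟨u1, u2, u3⟩ := hc i k j hij q.symm
    obtain ⟨v1, v2, v3⟩ := hc i k l p' hlk.symm
    have : Commute (O i k) (O j l) :=
      (((u1.mul_right v1).smul_right _).add_right (u2.mul_right v3)).add_right (u3.mul_right v2)
    rw [br_smul_lie, br_lie_smul, this.br_eq, smul_zero, smul_zero]
  have b6 : (z i - z j)⁻¹ • (br (O i j) (∑ k ∈ S, (z j - z k)⁻¹ • O j k))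
      + (z i - z j)⁻¹ • (br (O i j) (∑ k ∈ S, (z i - z k)⁻¹ • O i k))
      + ∑ k ∈ S, ((z i - z k)⁻¹ * (z j - z k)⁻¹) • (br (O i k) (O j k)) = 0 := by
    rw [br_lie_sum, br_lie_sum, Finset.smul_sum, Finset.smul_sum, ← Finset.sum_add_distrib,
      ← Finset.sum_add_distrib]
    refine Finset.sum_eq_zero fun k hk => ?_
    obtain ⟨p, q⟩ := hmem k hk
    have t1 : (br (O i j) (O i k)) = -(br (O i j) (O j k)) := by
      have := (h3 i j k hij p q).br_eq
      rw [br_lie_add] at this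
      exact eq_neg_of_add_eq_zero_left this
    have t2 : (br (O i k) (O j k)) = -(br (O i j) (O j k)) := by
      have := (h3 j k i q hji p.symm).br_eq
      rw [hs j i hji, hs k i p.symm, br_lie_add, ← br_lie_skew, ← br_lie_skew (O j k) (O i k)] at this
      have := eq_neg_of_add_eq_zero_right this
      rw [neg_neg] at this
      rw [← this, neg_neg]
    have n1 := sub_ne_zero.mpr (hz i j hij)
    have n2 := sub_ne_zero.mpr (hz i k p)
    have n3 := sub_ne_zero.mpr (hz j k q)
    rw [br_lie_smul, br_lie_smul, t1, t2]
    have : (z i - z j)⁻¹ * (z j - z k)⁻¹ - (z i - z j)⁻¹ * (z i - z k)⁻¹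
        - (z i - z k)⁻¹ * (z j - z k)⁻¹ = 0 := by
      field_simp
      ring
    calc _ = ((z i - z j)⁻¹ * (z j - z k)⁻¹ - (z i - z j)⁻¹ * (z i - z k)⁻¹
        - (z i - z k)⁻¹ * (z j - z k)⁻¹) • (br (O i j) (O j k)) := by module
      _ = 0 := by rw [this, zero_smul]
  have b7 : (br (H i) (O i j)) = -(br (O i j) (H i)) := (br_lie_skew _ _).symm
  rw [← b5] at b6
  rw [← sub_eq_zero, ← br_def, hAi, hAj]
  generalize ∑ k ∈ S, (z i - z k)⁻¹ • O i k = P at *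
  generalize ∑ k ∈ S, (z j - z k)⁻¹ • O j k = Q at *
  have b8 : (br (P) (O i j)) = -(br (O i j) (P)) := (br_lie_skew _ _).symm
  simp only [br_lie_add, br_add_lie, br_lie_smul, br_smul_lie, b1, b2, b3, b4, b7, b8, br_lie_self]
  refine Eq.trans ?_ b6
  module
end

section
/- Let F be a field, m ≥ 2, let w_1, …, w_m ∈ F be pairwise distinct, and let a, c ∈ F satisfy w_p ≠ a and w_p ≠ c for all p. Then ∑_{p ≠ n} 1/((w_p − w_n)(w_p − a)(w_n − c)) = ∑_{p < n} [ 1/((w_p − a)(w_n − c)(w_p − c)) − 1/((w_p − a)(w_n − a)(w_p − c)) ], where the left sum is over all ordered pairs (p,n) with p ≠ n and the right sum over unordered pairs p < n. -/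
/-!
STATEMENT 15: the general cancellation identity for `m` screening variables:
`∑_{p ≠ n} 1/((w_p − w_n)(w_p − a)(w_n − c))
  = ∑_{p < n} [ 1/((w_p − a)(w_n − c)(w_p − c)) − 1/((w_p − a)(w_n − a)(w_p − c)) ]`,
the left-hand sum over ordered pairs `(p, n)` with `p ≠ n`, the right-hand
sum over unordered pairs `p < n`.
-/

open Finset

theorem screening_cancellation_identity {F : Type*} [Field F] (m : ℕ)
    (hm : 2 ≤ m) (w : Fin m → F) (hw : Function.Injective w) (a c : F)
    (ha : ∀ p, w p ≠ a) (hc : ∀ p, w p ≠ c) :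
    ∑ p : Fin m, ∑ n ∈ Finset.univ.erase p,
        1 / ((w p - w n) * (w p - a) * (w n - c))
      = ∑ p : Fin m, ∑ n ∈ Finset.univ.filter (fun n => p < n),
          (1 / ((w p - a) * (w n - c) * (w p - c))
            - 1 / ((w p - a) * (w n - a) * (w p - c))) := by
  have key : ∀ f : Fin m → Fin m → F,
      ∑ p : Fin m, ∑ n ∈ Finset.univ.erase p, f p n
        = ∑ p : Fin m, ∑ n ∈ Finset.univ.filter (fun n => p < n), (f p n + f n p) := by
    intro f
    have h1 : ∀ p : Fin m, ∑ n ∈ Finset.univ.erase p, f p n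
        = ∑ n, (if p < n then f p n else 0) + ∑ n, (if n < p then f p n else 0) := by
      intro p
      have he : Finset.univ.erase p = Finset.univ.filter (fun n => n ≠ p) := by
        ext n; simp
      rw [he, Finset.sum_filter, ← Finset.sum_add_distrib]
      refine Finset.sum_congr rfl fun n _ => ?_
      rcases lt_trichotomy p n with h | h | h
      · simp [h, h.ne', h.not_gt]
      · simp [h]
      · simp [h, h.ne, h.not_gt]
    simp only [h1, Finset.sum_add_distrib, Finset.sum_filter]
    congr 1
    exact Finset.sum_comm
  rw [key]
  refine Finset.sum_congr rfl fun p _ => Finset.sum_congr rfl fun n hn => ?_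
  have hlt : p < n := by simpa using hn
  have h1 : w p - w n ≠ 0 := sub_ne_zero.mpr fun h => hlt.ne (hw h)
  have h2 : w n - w p ≠ 0 := sub_ne_zero.mpr fun h => hlt.ne' (hw h)
  have h3 := sub_ne_zero.mpr (ha p)
  have h4 := sub_ne_zero.mpr (ha n)
  have h5 := sub_ne_zero.mpr (hc p)
  have h6 := sub_ne_zero.mpr (hc n)
  have e : w n - w p = -(w p - w n) := by ring
  rw [e]
  field_simp
  ring
end

section
/- Let N ≥ 2, let b, Λ, k_1, …, k_N be real numbers with b ≠ 0, and let D = {(w_1, w_2, z_1, …, z_N) ∈ ℝ^{N+2} : w_1 > w_2 > z_1 > z_2 > … > z_N}. Define A : D → ℝ by A(w_1, w_2, z) = exp(Λ(w_1+w_2)/b²) · (w_1 − w_2)^{−2/b²} · ∏_{a=1}^N (w_1 − z_a)^{k_a/b²} (w_2 − z_a)^{k_a/b²} (real powers via rpow). Then for all distinct indices i ≠ j, the integrand A satisfies pointwise on D: ∂²A/∂z_i∂z_j = (k_i k_j / b⁴)·( 1/((w_1 − z_i)(w_2 − z_j)) + 1/((w_2 − z_i)(w_1 − z_j)) )·A +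 (1/(z_i − z_j))·( −(k_j/b²)·∂A/∂z_i + (k_i/b²)·∂A/∂z_j ). -/
open Finset

/-- The two-screening-charge integrand `A(w_1, w_2, z)` (real powers are
`Real.rpow`; on `D` all bases of the powers are positive). -/
noncomputable def Aint (N : ℕ) (b Λ : ℝ) (k : Fin N → ℝ)
    (w₁ w₂ : ℝ) (z : Fin N → ℝ) : ℝ :=
  Real.exp (Λ * (w₁ + w₂) / b ^ 2) * (w₁ - w₂) ^ (-2 / b ^ 2) *
    ∏ a, ((w₁ - z a) ^ (k a / b ^ 2) * (w₂ - z a) ^ (k a / b ^ 2))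

theorem aux_split (N : ℕ) (b Λ : ℝ) (k : Fin N → ℝ) (w₁ w₂ : ℝ) (z : Fin N → ℝ)
    (i j : Fin N) (hij : i ≠ j) : ∃ C : ℝ, ∀ s t : ℝ,
    Aint N b Λ k w₁ w₂ (Function.update (Function.update z i s) j t) =
      C * ((w₁ - s) ^ (k i / b ^ 2) * (w₂ - s) ^ (k i / b ^ 2)) *
        ((w₁ - t) ^ (k j / b ^ 2) * (w₂ - t) ^ (k j / b ^ 2)) := by
  refine ⟨Real.exp (Λ * (w₁ + w₂) / b ^ 2) * (w₁ - w₂) ^ (-2 / b ^ 2) *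
    ∏ a ∈ (univ.erase j).erase i,
      ((w₁ - z a) ^ (k a / b ^ 2) * (w₂ - z a) ^ (k a / b ^ 2)), fun s t => ?_⟩
  unfold Aint
  rw [← Finset.mul_prod_erase univ _ (Finset.mem_univ j),
    ← Finset.mul_prod_erase (univ.erase j) _ (Finset.mem_erase.2 ⟨hij, Finset.mem_univ i⟩)]
  have h : ∏ a ∈ (univ.erase j).erase i,
      ((w₁ - Function.update (Function.update z i s) j t a) ^ (k a / b ^ 2) *
        (w₂ - Function.update (Function.update z i s) j t a) ^ (k a / b ^ 2)) =
      ∏ a ∈ (univ.erase j).erase i,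
      ((w₁ - z a) ^ (k a / b ^ 2) * (w₂ - z a) ^ (k a / b ^ 2)) := by
    refine Finset.prod_congr rfl fun a ha => ?_
    simp only [Finset.mem_erase] at ha
    rw [Function.update_of_ne ha.2.1, Function.update_of_ne ha.1]
  rw [h, Function.update_self, Function.update_of_ne hij, Function.update_self]
  ring

theorem aux_deriv (w₁ w₂ c x : ℝ) (h1 : 0 < w₁ - x) (h2 : 0 < w₂ - x) :
    HasDerivAt (fun t : ℝ => (w₁ - t) ^ c * (w₂ - t) ^ c)
      (-c * (1 / (w₁ - x) + 1 / (w₂ - x)) * ((w₁ - x) ^ c * (w₂ - x) ^ c)) x := by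
  have d1 := ((hasDerivAt_id x).const_sub w₁).rpow_const (p := c) (Or.inl h1.ne')
  have d2 := ((hasDerivAt_id x).const_sub w₂).rpow_const (p := c) (Or.inl h2.ne')
  refine (d1.mul d2).congr_deriv ?_
  simp only [id]

  rw [Real.rpow_sub_one h1.ne', Real.rpow_sub_one h2.ne']
  field_simp
  ring

theorem Aint_second_partials_identity (N : ℕ) (hN : 2 ≤ N)
    (b Λ : ℝ) (k : Fin N → ℝ) (hb : b ≠ 0)
    (w₁ w₂ : ℝ) (z : Fin N → ℝ)
    (hz : StrictAnti z) (hzw : ∀ a, z a < w₂) (hw : w₂ < w₁)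
    (i j : Fin N) (hij : i ≠ j) :
    deriv (fun s =>
        deriv (fun t =>
            Aint N b Λ k w₁ w₂ (Function.update (Function.update z i s) j t))
          (z j))
      (z i)
      = (k i * k j / b ^ 4)
          * (1 / ((w₁ - z i) * (w₂ - z j)) + 1 / ((w₂ - z i) * (w₁ - z j)))
          * Aint N b Λ k w₁ w₂ z
        + (1 / (z i - z j))
          * (-(k j / b ^ 2)
                * deriv (fun t => Aint N b Λ k w₁ w₂ (Function.update z i t))
                    (z i)
              + (k i / b ^ 2)
                * deriv (fun t => Aint N b Λ k w₁ w₂ (Function.update z j t))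
                    (z j)) := by
  obtain ⟨C, hC⟩ := aux_split N b Λ k w₁ w₂ z i j hij
  have hi2 : 0 < w₂ - z i := sub_pos.2 (hzw i)
  have hj2 : 0 < w₂ - z j := sub_pos.2 (hzw j)
  have hi1 : 0 < w₁ - z i := by linarith
  have hj1 : 0 < w₁ - z j := by linarith
  have hne : z i - z j ≠ 0 := sub_ne_zero.2 fun h => hij (hz.injective h)
  have di := aux_deriv w₁ w₂ (k i / b ^ 2) (z i) hi1 hi2
  have dj := aux_deriv w₁ w₂ (k j / b ^ 2) (z j) hj1 hj2
  have e0 := hC (z i) (z j)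
  rw [Function.update_eq_self, Function.update_eq_self] at e0
  have ei : ∀ t, Aint N b Λ k w₁ w₂ (Function.update z i t) =
      C * ((w₁ - t) ^ (k i / b ^ 2) * (w₂ - t) ^ (k i / b ^ 2)) *
        ((w₁ - z j) ^ (k j / b ^ 2) * (w₂ - z j) ^ (k j / b ^ 2)) := fun t => by
    rw [← hC t (z j), Function.update_comm hij, Function.update_eq_self]
  have ej : ∀ t, Aint N b Λ k w₁ w₂ (Function.update z j t) =
      C * ((w₁ - z i) ^ (k i / b ^ 2) * (w₂ - z i) ^ (k i / b ^ 2)) *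
        ((w₁ - t) ^ (k j / b ^ 2) * (w₂ - t) ^ (k j / b ^ 2)) := fun t => by
    rw [← hC (z i) t, Function.update_eq_self]
  simp only [hC, ei, ej, e0]
  rw [((di.const_mul C).mul_const _).deriv, (dj.const_mul _).deriv]
  have hin : (fun s => deriv (fun t => C * ((w₁ - s) ^ (k i / b ^ 2) * (w₂ - s) ^ (k i / b ^ 2)) *
        ((w₁ - t) ^ (k j / b ^ 2) * (w₂ - t) ^ (k j / b ^ 2))) (z j)) = _ :=
    funext fun s => (dj.const_mul _).deriv
  rw [hin, ((di.const_mul C).mul_const _).deriv]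
  generalize (w₁ - z i) ^ (k i / b ^ 2) * (w₂ - z i) ^ (k i / b ^ 2) = P
  generalize (w₁ - z j) ^ (k j / b ^ 2) * (w₂ - z j) ^ (k j / b ^ 2) = Q
  have n1 := hi1.ne'
  have n2 := hi2.ne'
  have n3 := hj1.ne'
  have n4 := hj2.ne'
  field_simp
  ring
end
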